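/- Let G be a finite group and suppose every second maximal subgroup H of G satisfies: there exists a maximal subgroup M of G containing H with H_G < M_G (strict containment of normal cores). Then G is solvable. -/

import Mathlib

/-- `H` is a second maximal subgroup of `G`: it is a maximal subgroup of some
maximal subgroup of `G`. -/
def IsSecondMaximal {G : Type*} [Group G] (H : Subgroup G) : Prop :=
  ∃ M : Subgroup G, IsCoatom M ∧ H ≤ M ∧ IsCoatom (H.subgroupOf M)

theorem gasch {G E B : Type*} [Group G] [Group E] [Group B] [Finite G] [Finite E]
    (π : G →* B) (ρ : E →* B) (hρ : Function.Surjective ρ)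
    (hcomm : ∀ a ∈ ρ.ker, ∀ b ∈ ρ.ker, a * b = b * a)
    (M : Subgroup G) (f0 : M →* E) (hf0 : ∀ m : M, ρ (f0 m) = π m)
    (hcop : Nat.Coprime M.index (Nat.card ρ.ker)) :
    ∃ f : G →* E, ∀ g, ρ (f g) = π g := by
  classical
  -- a section of `G → G ⧸ M`
  have hout : ∀ g : G, ∃ m : M, (QuotientGroup.mk (s := M) g).out = g * m := fun g =>
    (QuotientGroup.mk_out_eq_mul M g)
  choose l hl using fun b => hρ b
  let r : G → G := fun g => (QuotientGroup.mk (s := M) g).out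
  have hr : ∀ g, (r g)⁻¹ * g ∈ M := fun g => by
    obtain ⟨m, hm⟩ := hout g
    simp only [r, hm]
    simp
  let F : G → E := fun g => l (π (r g)) * f0 ⟨(r g)⁻¹ * g, hr g⟩
  have hF : ∀ g, ρ (F g) = π g := fun g => by simp [F, hl, hf0]
  have hFm : ∀ g (m : M), F (g * m) = F g * f0 m := fun g m => by
    have h1 : r (g * m) = r g := by
      simp only [r]; rw [QuotientGroup.mk_mul_of_mem g m.2]
    have h2 : (⟨(r (g * m))⁻¹ * (g * m), hr _⟩ : M) = ⟨(r g)⁻¹ * g, hr g⟩ * m := by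
      ext; simp [h1, mul_assoc]
    simp only [F]
    rw [h2, h1, map_mul, mul_assoc]
  let _ : CommGroup ρ.ker := { (inferInstance : Group ρ.ker) with
    mul_comm := fun a b => Subtype.ext (hcomm a a.2 b b.2) }
  let c : G → G → ρ.ker := fun g h => ⟨F g * F h * (F (g * h))⁻¹, by
    rw [MonoidHom.mem_ker]; simp [hF]⟩
  have hcm : ∀ g h (m : M), c g (h * m) = c g h := fun g h m => by
    ext
    simp only [c]
    rw [← mul_assoc g h, hFm, hFm]; group
  let act : G → ρ.ker →* ρ.ker := fun g =>
    { toFun := fun a => ⟨F g * a * (F g)⁻¹, ρ.normal_ker.conj_mem _ a.2 _⟩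
      map_one' := by ext; simp
      map_mul' := fun a b => by ext; simp }
  have hcoc : ∀ g h k, c g h * c (g * h) k = act g (c h k) * c g (h * k) := fun g h k => by
    ext
    simp only [c, act, Subgroup.coe_mul, MonoidHom.coe_mk, OneHom.coe_mk]
    rw [mul_assoc g h k]; group
  have : Fintype (G ⧸ M) := Fintype.ofFinite _
  let b : G → ρ.ker := fun g => ∏ x : G ⧸ M, c g x.out
  have hsum : ∀ g h, ∏ x : G ⧸ M, c g (h * x.out) = b g := fun g h => by
    refine Fintype.prod_equiv (MulAction.toPerm h) _ _ fun x => ?_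
    have : (h • x) = QuotientGroup.mk (s := M) (h * x.out) := by
      conv_lhs => rw [← QuotientGroup.out_eq' x]
      rfl
    obtain ⟨m, hm⟩ := hout (h * x.out)
    rw [MulAction.toPerm_apply, this, hm, hcm]
  have hb : ∀ g h, c g h ^ M.index * b (g * h) = act g (b h) * b g := fun g h => by
    have := Finset.prod_congr (rfl : (Finset.univ : Finset (G ⧸ M)) = _)
      (fun x _ => hcoc g h x.out)
    rw [Finset.prod_mul_distrib, Finset.prod_mul_distrib, hsum, Finset.prod_const,
      ← map_prod] at this
    rw [Subgroup.index, Nat.card_eq_fintype_card]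
    exact this
  obtain ⟨n, hn⟩ : ∃ n : ℤ, ∀ a : ρ.ker, (a ^ M.index) ^ n = a := by
    refine ⟨_, fun a => (powCoprime hcop.symm).symm_apply_apply a⟩
  let b' : G → ρ.ker := fun g => b g ^ n
  have hb' : ∀ g h, c g h * b' (g * h) = act g (b' h) * b' g := fun g h => by
    simp only [b']
    conv_lhs => rw [← hn (c g h)]
    rw [← mul_zpow, hb, mul_zpow, map_zpow]
  refine ⟨MonoidHom.mk' (fun g => (b' g : E)⁻¹ * F g) fun g h => ?_, fun g => ?_⟩
  · have h1 := hb' g h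
    have h2 : act g (b' h) * b' g = b' g * act g (b' h) := mul_comm _ _
    rw [h2] at h1
    have h3 := congrArg (Subtype.val) h1
    rw [mul_comm (c g h)] at h3
    replace h3 := congrArg (Subtype.val) h1
    have h4 : c g h * b' (g * h) = b' (g * h) * c g h := mul_comm _ _
    rw [h4] at h1
    have h5 := congrArg Subtype.val h1
    simp only [c, act, Subgroup.coe_mul, MonoidHom.coe_mk, OneHom.coe_mk] at h5
    have h6 : F (g * h) = (F g * (b' h : E) * (F g)⁻¹)⁻¹ * (b' g : E)⁻¹ * (b' (g * h) : E)
        * F g * F h := by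
      have := congrArg (fun z => z⁻¹ * (b' (g*h) : E) * F g * F h) h5
      simp only [mul_inv_rev, inv_inv] at this
      simp only [mul_inv_rev, inv_inv]
      calc _ = _ := ?_
        _ = _ := this
        _ = _ := ?_
      all_goals group
    have h7 : (b' (g * h) : E)⁻¹ * ((F g * (b' h : E) * (F g)⁻¹)⁻¹ * (b' g : E)⁻¹) * (b' (g * h) : E)
        = ((b' g : E)⁻¹ * (F g * (b' h : E) * (F g)⁻¹)⁻¹) := by
      have : (b' (g * h))⁻¹ * ((act g (b' h))⁻¹ * (b' g)⁻¹) * b' (g * h)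
        = (b' g)⁻¹ * (act g (b' h))⁻¹ := by
        rw [mul_comm (act g (b' h))⁻¹, mul_comm (b' (g*h))⁻¹, inv_mul_cancel_right]
      exact congrArg Subtype.val this
    show (b' (g * h) : E)⁻¹ * F (g * h) = (b' g : E)⁻¹ * F g * ((b' h : E)⁻¹ * F h)
    calc _ = ((b' (g * h) : E)⁻¹ * ((F g * (b' h : E) * (F g)⁻¹)⁻¹ * (b' g : E)⁻¹) * (b' (g * h) : E)) * F g * F h := by
            rw [h6]; simp only [mul_assoc]
      _ = _ := by rw [h7]; group
  · have := (b' g).2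
    rw [MonoidHom.mem_ker] at this
    show ρ ((b' g : E)⁻¹ * F g) = π g
    simp [this, hF]

/-- The hypothesis passes to quotients. -/
theorem hyp_quot {G : Type*} [Group G]
    (h : ∀ H : Subgroup G, IsSecondMaximal H →
      ∃ M : Subgroup G, IsCoatom M ∧ H ≤ M ∧ H.normalCore < M.normalCore)
    (D : Subgroup G) [D.Normal] (H : Subgroup (G ⧸ D)) (hH : IsSecondMaximal H) :
    ∃ M : Subgroup (G ⧸ D), IsCoatom M ∧ H ≤ M ∧ H.normalCore < M.normalCore := by
  have hs : Function.Surjective (QuotientGroup.mk' D) := QuotientGroup.mk'_surjective D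
  obtain ⟨M, hM, hHM, hc⟩ := hH
  have h2 : IsSecondMaximal (H.comap (QuotientGroup.mk' D)) := by
    refine ⟨M.comap (QuotientGroup.mk' D), Subgroup.isCoatom_comap_of_surjective hs hM,
      Subgroup.comap_mono hHM, ?_⟩
    have := Subgroup.isCoatom_comap_of_surjective
      ((QuotientGroup.mk' D).subgroupComap_surjective_of_surjective M hs) hc
    exact this
  obtain ⟨M', hM', hHM', hlt⟩ := h _ h2
  have hD : D ≤ H.comap (QuotientGroup.mk' D) := by
    intro x hx
    rw [Subgroup.mem_comap, QuotientGroup.mk'_apply, (QuotientGroup.eq_one_iff x).2 hx]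
    exact H.one_mem
  have hker : (QuotientGroup.mk' D).ker ≤ M' := by
    rw [QuotientGroup.ker_mk']; exact hD.trans hHM'
  have hMM : (M'.map (QuotientGroup.mk' D)).comap (QuotientGroup.mk' D) = M' :=
    Subgroup.comap_map_eq_self hker
  have hle : H ≤ M'.map (QuotientGroup.mk' D) := by
    rw [← Subgroup.map_comap_eq_self_of_surjective hs H]
    exact Subgroup.map_mono hHM'
  refine ⟨M'.map (QuotientGroup.mk' D), ?_, hle, ?_⟩
  · refine ⟨fun e => hM'.1 (by rw [← hMM, e, Subgroup.comap_top]), fun K hK => ?_⟩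
    have : M' < K.comap (QuotientGroup.mk' D) := by
      conv_lhs => rw [← hMM]
      exact (Subgroup.comap_lt_comap_of_surjective hs).2 hK
    have := hM'.2 _ this
    rw [← Subgroup.map_comap_eq_self_of_surjective hs K, this,
      Subgroup.map_top_of_surjective _ hs]
  · refine lt_of_le_of_ne (Subgroup.normalCore_mono hle) fun e => ?_
    refine hlt.not_ge ?_
    rw [Subgroup.normal_le_normalCore]
    have h1 : (M'.normalCore.map (QuotientGroup.mk' D)) ≤ H := by
      have : (M'.normalCore.map (QuotientGroup.mk' D)).Normal :=
        Subgroup.Normal.map inferInstance _ hs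
      have h3 : (M'.normalCore.map (QuotientGroup.mk' D)) ≤
          (M'.map (QuotientGroup.mk' D)).normalCore :=
        Subgroup.normal_le_normalCore.2 (Subgroup.map_mono (Subgroup.normalCore_le _))
      rw [← e] at h3
      exact h3.trans (Subgroup.normalCore_le _)
    exact Subgroup.map_le_iff_le_comap.1 h1

/-- The solvable residual, in the situation that all proper quotients are solvable. -/
theorem exists_residual {G : Type*} [Group G] [Finite G] (hG : ¬ Group.IsSolvable G)
    (hq : ∀ D : Subgroup G, ∀ _ : D.Normal, D ≠ ⊥ → Group.IsSolvable (G ⧸ D)) :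
    ∃ N : Subgroup G, N.Normal ∧ N ≠ ⊥ ∧ ⁅N, N⁆ = N ∧
      ∀ D : Subgroup G, D.Normal → D ≠ ⊥ → N ≤ D := by
  obtain ⟨n, hn⟩ : ∃ n, ∀ m, n ≤ m → derivedSeries G n = derivedSeries G m := by
    obtain ⟨n, hn⟩ := WellFoundedGT.monotone_chain_condition
      (α := (Subgroup G)ᵒᵈ)
      ⟨fun n => OrderDual.toDual (derivedSeries G n), fun a b hab => derivedSeries_antitone G hab⟩
    exact ⟨n, fun m hm => hn m hm⟩
  refine ⟨derivedSeries G n, inferInstance, fun e => hG ⟨n, e⟩, ?_, fun D hD hD1 => ?_⟩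
  · rw [← derivedSeries_succ, ← hn (n + 1) (by omega)]
  · obtain ⟨k, hk⟩ := hq D hD hD1
    have h1 : derivedSeries G n ≤ derivedSeries G k := by
      rcases le_total n k with h | h
      · exact (hn k h).le
      · exact derivedSeries_antitone G h
    have h2 := map_derivedSeries_le_derivedSeries (QuotientGroup.mk' D) k
    rw [hk, Subgroup.map_le_iff_le_comap, MonoidHom.comap_bot, QuotientGroup.ker_mk'] at h2
    exact h1.trans h2

theorem key {G : Type*} [Group G] [Finite G]
    (h : ∀ H : Subgroup G, IsSecondMaximal H →
      ∃ M : Subgroup G, IsCoatom M ∧ H ≤ M ∧ H.normalCore < M.normalCore)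
    (N : Subgroup G) (hN : N.Normal) (hN1 : N ≠ ⊥) (hNN : ⁅N, N⁆ = N)
    (hmin : ∀ D : Subgroup G, D.Normal → D ≠ ⊥ → N ≤ D) : False := by
  -- no nontrivial solvable normal subgroups
  have hsol : ∀ D : Subgroup G, D.Normal → Group.IsSolvable D → D = ⊥ := fun D hD hs => by
    by_contra hD1
    have hND := hmin D hD hD1
    have hN2 : N.subgroupOf D ≠ ⊥ := fun e => hN1 (by
      rw [Subgroup.subgroupOf_eq_bot] at e
      exact le_bot_iff.1 (e le_rfl hND))
    have h1 := Group.IsSolvable.commutator_lt_of_ne_bot hN2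
    refine h1.ne ?_
    apply Subgroup.map_injective D.subtype_injective
    rw [Subgroup.map_commutator, Subgroup.subgroupOf_map_subtype, inf_of_le_left hND, hNN]
  -- normalizers of nontrivial p-subgroups are proper
  have hnorm : ∀ (p : ℕ) (_ : Fact p.Prime) (Q : Subgroup G), IsPGroup p Q → Q ≠ ⊥ →
      Subgroup.normalizer (Q : Set G) ≠ ⊤ := fun p hp Q hQ hQ1 e => by
    have := hQ.isNilpotent
    exact hQ1 (hsol Q (Subgroup.normalizer_eq_top_iff.1 e) inferInstance)
  -- choose a maximal subgroup
  obtain ⟨M, hM, hMN, hMK⟩ : ∃ M : Subgroup G, IsCoatom M ∧ M ⊔ N = ⊤ ∧ M ⊓ N ≠ ⊥ := by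
    have hcard : Nat.card N ≠ 1 := fun e => hN1 (Subgroup.card_eq_one.1 e)
    obtain ⟨p, hp, hpd⟩ := Nat.exists_prime_and_dvd hcard
    have : Fact p.Prime := ⟨hp⟩
    let P : Sylow p N := default
    have hP1 : (P : Subgroup N) ≠ ⊥ := P.ne_bot_of_dvd_card hpd
    let Q : Subgroup G := (P : Subgroup N).map N.subtype
    have hQ1 : Q ≠ ⊥ := fun e => hP1 ((Subgroup.map_eq_bot_iff_of_injective _ N.subtype_injective).1 e)
    have hQ : IsPGroup p Q := P.2.map _
    obtain h1 | ⟨M, hM, hle⟩ := eq_top_or_exists_le_coatom (Subgroup.normalizer (Q : Set G))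
    · exact (hnorm p this Q hQ hQ1 h1).elim
    · refine ⟨M, hM, top_le_iff.1 ?_, fun e => hQ1 ?_⟩
      · rw [← Sylow.normalizer_sup_eq_top P]
        exact sup_le_sup_right hle _
      · rw [← le_bot_iff, ← e]
        exact le_inf (Subgroup.le_normalizer.trans hle) (Subgroup.map_subtype_le _)
  have hNM : ¬ N ≤ M := fun e => hM.1 (by rw [← hMN, sup_eq_left.2 e])
  let K : Subgroup M := N.subgroupOf M
  have hKn : K.Normal := inferInstance
  -- K is contained in all maximal subgroups of M
  have hK : ∀ H : Subgroup M, IsCoatom H → K ≤ H := fun H hH => by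
    by_contra hKH
    have hsub : (H.map M.subtype).subgroupOf M = H :=
      Subgroup.comap_map_eq_self_of_injective M.subtype_injective H
    obtain ⟨M', hM', hle, hlt⟩ := h (H.map M.subtype)
      ⟨M, hM, Subgroup.map_subtype_le _, by rw [hsub]; exact hH⟩
    have hNM' : N ≤ M' := (hmin M'.normalCore inferInstance
      (ne_bot_of_gt hlt)).trans (Subgroup.normalCore_le _)
    have htop : H ⊔ K = ⊤ := hH.2 _ (left_lt_sup.2 hKH)
    have hMM' : M ≤ M' := by
      have : (H ⊔ K).map M.subtype ≤ M' := by
        rw [Subgroup.map_sup]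
        refine sup_le hle ?_
        rw [Subgroup.subgroupOf_map_subtype]
        exact inf_le_left.trans hNM'
      rw [htop] at this
      rwa [← MonoidHom.range_eq_map, Subgroup.range_subtype] at this
    rcases hMM'.eq_or_lt with e | e
    · exact hNM (e ▸ hNM')
    · exact hM'.1 (hM.2 _ e)
  have hK1 : K ≠ ⊥ := fun e => hMK (by
    rw [Subgroup.subgroupOf_eq_bot] at e
    rw [inf_comm]; exact e.eq_bot)
  have hKF : K ≤ frattini M := by
    rw [frattini, Order.radical]
    exact le_iInf₂ fun H hH => hK H hH
  have hKnil : Group.IsNilpotent K := by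
    have := frattini_nilpotent (G := M)
    have h2 : Group.IsNilpotent (K.subgroupOf (frattini M)) := inferInstance
    exact Group.nilpotent_of_mulEquiv (Subgroup.subgroupOfEquivOfLe hKF)
  -- coprimality
  have hcop : Nat.Coprime M.index (Nat.card K) := by
    refine Nat.Coprime.symm (Nat.coprime_of_dvd fun q hq hqK hqM => ?_)
    have : Fact q.Prime := ⟨hq⟩
    let P : Sylow q K := default
    have hP1 : (P : Subgroup K) ≠ ⊥ := P.ne_bot_of_dvd_card hqK
    have hPn : (P : Subgroup K).Normal := 
      P.normal_of_normalizerCondition Group.normalizerCondition_of_isNilpotent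
    have hPc := P.characteristic_of_normal hPn
    let P' : Subgroup M := (P : Subgroup K).map K.subtype
    have hP'n : P'.Normal := inferInstance
    let Q : Subgroup G := P'.map M.subtype
    have hQ1 : Q ≠ ⊥ := fun e => hP1
      ((Subgroup.map_eq_bot_iff_of_injective _ K.subtype_injective).1
        ((Subgroup.map_eq_bot_iff_of_injective _ M.subtype_injective).1 e))
    have hQ : IsPGroup q Q := (P.2.map _).map _
    have hQN : ∀ x ∈ Q, x ∈ M ∧ x ∈ N ∧ ∃ k : ℕ, x ^ q ^ k = 1 := by
      intro x hx
      obtain ⟨k, hk⟩ := hQ ⟨x, hx⟩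
      obtain ⟨y, ⟨z, hz, rfl⟩, rfl⟩ := hx
      exact ⟨z.1.2, z.2, k, congrArg Subtype.val hk⟩
    have hQmem : ∀ x, x ∈ M → x ∈ N → (∃ k : ℕ, x ^ q ^ k = 1) → x ∈ Q := by
      rintro x hxM hxN ⟨k, hk⟩
      let y : K := ⟨⟨x, hxM⟩, hxN⟩
      have hyk : y ^ q ^ k = 1 := by
        apply Subtype.ext; apply Subtype.ext; exact hk
      have hy : IsPGroup q (Subgroup.zpowers y) := by
        rintro ⟨z, n, rfl⟩
        refine ⟨k, Subtype.ext ?_⟩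
        show (y ^ n) ^ q ^ k = 1
        rw [← zpow_natCast, ← zpow_mul, mul_comm, zpow_mul, zpow_natCast, hyk, one_zpow]
      obtain ⟨P2, hP2⟩ := hy.exists_le_sylow
      have := P.unique_of_normal hPn
      have e : P2 = P := Subsingleton.elim _ _
      rw [e] at hP2
      exact ⟨⟨x, hxM⟩, ⟨y, hP2 (Subgroup.mem_zpowers y), rfl⟩, rfl⟩
    have hconj : ∀ g : G, (∀ x ∈ Q, g * x * g⁻¹ ∈ M) → g ∈ Subgroup.normalizer (Q : Set G) := by
      intro g hg
      refine Subgroup.mem_normalizer_fintype fun x hx => ?_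
      obtain ⟨_, h2, k, hk⟩ := hQN x hx
      exact hQmem _ (hg x hx) (hN.conj_mem _ h2 _) ⟨k, by rw [conj_pow, hk]; simp⟩
    have hMQ : M ≤ Subgroup.normalizer (Q : Set G) := fun m hm =>
      hconj m fun x hx => M.mul_mem (M.mul_mem hm (hQN x hx).1) (M.inv_mem hm)
    have hMQ' : Subgroup.normalizer (Q : Set G) = M := by
      rcases hMQ.eq_or_lt with e | e
      · exact e.symm
      · exact (hnorm q this Q hQ hQ1 (hM.2 _ e)).elim
    have hfix : ((1 : G) : G ⧸ M) ∈ MulAction.fixedPoints Q (G ⧸ M) := by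
      intro x
      show ((x.1 * 1 : G) : G ⧸ M) = _
      rw [eq_comm, QuotientGroup.eq]
      simpa using (hQN x x.2).1
    obtain ⟨b, hb, hb1⟩ := hQ.exists_fixed_point_of_prime_dvd_card_of_fixed_point (G ⧸ M)
      hqM hfix
    obtain ⟨g, rfl⟩ := QuotientGroup.mk_surjective b
    apply hb1
    rw [QuotientGroup.eq, inv_one, one_mul, ← M.inv_mem_iff, ← hMQ']
    refine hconj _ fun x hx => ?_
    have h1 : ((x * g : G) : G ⧸ M) = g := hb ⟨x, hx⟩
    rw [eq_comm, QuotientGroup.eq] at h1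
    simpa [mul_assoc] using h1
  -- the extension `M ⧸ ⁅K, K⁆` of `G ⧸ N` by `K ⧸ ⁅K, K⁆`
  let L : Subgroup M := ⁅K, K⁆
  have hLK : L ≤ K := Subgroup.commutator_le_left K K
  let ρ : M ⧸ L →* G ⧸ N := QuotientGroup.lift L ((QuotientGroup.mk' N).comp M.subtype)
    fun x hx => (QuotientGroup.eq_one_iff _).2 (hLK hx)
  have hρm : ∀ m : M, ρ (m : M ⧸ L) = ((m : G) : G ⧸ N) := fun m => rfl
  have hρs : Function.Surjective ρ := by
    intro b
    obtain ⟨g, rfl⟩ := QuotientGroup.mk_surjective b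
    have hg : g ∈ M ⊔ N := hMN ▸ Subgroup.mem_top g
    obtain ⟨m, hm, n, hn, rfl⟩ := Subgroup.mem_sup_of_normal_right.1 hg
    refine ⟨((⟨m, hm⟩ : M) : M ⧸ L), ?_⟩
    rw [hρm, QuotientGroup.eq]
    simpa using hn
  have hker : ρ.ker = K.map (QuotientGroup.mk' L) := by
    ext x
    obtain ⟨m, rfl⟩ := QuotientGroup.mk_surjective x
    rw [MonoidHom.mem_ker, hρm, QuotientGroup.eq_one_iff]
    constructor
    · intro hm
      exact ⟨m, hm, rfl⟩
    · rintro ⟨k, hk, e⟩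
      have e' : (k : M ⧸ L) = m := e
      rw [QuotientGroup.eq] at e'
      have := K.mul_mem hk (hLK e')
      rwa [mul_inv_cancel_left] at this
  have hcomm : ∀ a ∈ ρ.ker, ∀ b ∈ ρ.ker, a * b = b * a := by
    rw [hker]
    rintro _ ⟨a, ha, rfl⟩ _ ⟨b, hb, rfl⟩
    rw [← map_mul, ← map_mul, eq_comm]
    refine QuotientGroup.eq.2 ?_
    have := Subgroup.commutator_mem_commutator (K.inv_mem ha) (K.inv_mem hb)
    rw [commutatorElement_def] at this
    convert this using 1
    group
  have hcop' : Nat.Coprime M.index (Nat.card ρ.ker) := by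
    rw [hker]
    exact Nat.Coprime.coprime_dvd_right (Subgroup.card_map_dvd _ _) hcop
  obtain ⟨f, hf⟩ := gasch (QuotientGroup.mk' N) ρ hρs hcomm M (QuotientGroup.mk' L)
    (fun m => rfl) hcop'
  have hfN : N ≤ f.ker := by
    rw [← hNN, Subgroup.commutator_le]
    have h1 : ∀ x ∈ N, f x ∈ ρ.ker := fun x hx => by
      rw [MonoidHom.mem_ker, hf]; exact (QuotientGroup.eq_one_iff _).2 hx
    intro a ha b hb
    rw [MonoidHom.mem_ker, map_commutatorElement, commutatorElement_eq_one_iff_mul_comm]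
    exact hcomm _ (h1 a ha) _ (h1 b hb)
  obtain hC | ⟨H, hH, hCH⟩ := eq_top_or_exists_le_coatom (f.range.comap (QuotientGroup.mk' L))
  · have hKL : K ≤ L := by
      intro k hk
      have : k ∈ f.range.comap (QuotientGroup.mk' L) := hC ▸ Subgroup.mem_top k
      obtain ⟨g, hg⟩ := this
      have h1 := hf g
      rw [hg] at h1
      have h2 : ((k : G) : G ⧸ N) = (g : G ⧸ N) := h1
      rw [(QuotientGroup.eq_one_iff (k : G)).2 hk, eq_comm, QuotientGroup.eq_one_iff] at h2
      have h3 := hfN h2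
      rw [MonoidHom.mem_ker, hg] at h3
      exact (QuotientGroup.eq_one_iff _).1 h3
    have hKt : (⊤ : Subgroup K) ≠ ⊥ := fun e => hK1 (by
      have := congrArg (Subgroup.map K.subtype) e
      rwa [← MonoidHom.range_eq_map, Subgroup.range_subtype, Subgroup.map_bot] at this)
    refine (Group.IsSolvable.commutator_lt_of_ne_bot hKt).ne ?_
    apply Subgroup.map_injective K.subtype_injective
    rw [Subgroup.map_commutator, ← MonoidHom.range_eq_map, Subgroup.range_subtype]
    exact le_antisymm hLK hKL
  · refine hH.1 (top_le_iff.1 fun m _ => ?_)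
    obtain ⟨c, hc⟩ := QuotientGroup.mk_surjective (f (m : G))
    have hcH : c ∈ H := hCH ⟨m, hc.symm⟩
    have h1 := hf m
    rw [← hc] at h1
    have h2 : ((c : G) : G ⧸ N) = ((m : G) : G ⧸ N) := h1
    rw [QuotientGroup.eq] at h2
    have h3 : c⁻¹ * m ∈ K := h2
    have := H.mul_mem hcH (hK H hH h3)
    rwa [mul_inv_cancel_left] at this

theorem stmt_11 {G : Type*} [Group G] [Finite G]
    (h : ∀ H : Subgroup G, IsSecondMaximal H →
      ∃ M : Subgroup G, IsCoatom M ∧ H ≤ M ∧ H.normalCore < M.normalCore) :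
    IsSolvable G := by
  induction hn : Nat.card G using Nat.strong_induction_on generalizing G with
  | _ n ih =>
    by_contra hG
    obtain ⟨N, hN, hN1, hNN, hmin⟩ := exists_residual hG fun D hD hD1 => by
      refine ih (Nat.card (G ⧸ D)) ?_ (fun H hH => hyp_quot h D H hH) rfl
      rw [← hn, Subgroup.card_eq_card_quotient_mul_card_subgroup D]
      have h1 : 1 < Nat.card D := D.one_lt_card_iff_ne_bot.2 hD1
      have h2 : 0 < Nat.card (G ⧸ D) := Nat.card_pos
      nlinarith
    exact key h N hN hN1 hNN hmin
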